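/- Let I ⊂ ℝ be a nondegenerate interval, N a positive integer, and a_0, a_1, …, a_N real numbers with a_0 ≠ 0 and a_N ≠ 0. If every complex root of the characteristic polynomial a_N r^N + … + a_1 r + a_0 is non-real, then there is no continuous function g : I → I satisfying a_N g^N(x) + … + a_1 g(x) + a_0 x = 0 for all x ∈ I. -/

import Mathlib

open Polynomial in
lemma aux_pow_re (z : ℂ) (hz : z.im ≠ 0) : ∃ m : ℕ, 0 < m ∧ (z ^ m).re ≤ 0 := by
  by_contra hcon
  push Not at hcon
  have hz0 : z ≠ 0 := by rintro rfl; simp at hz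
  have hr : 0 < ‖z‖ := norm_pos_iff.mpr hz0
  have hlt : z.re < ‖z‖ := lt_of_le_of_lt (le_abs_self _) (Complex.abs_re_lt_norm.mpr hz)
  set t : ℝ := 1 - z.re / ‖z‖ with ht
  have htpos : 0 < t := by
    rw [ht, sub_pos, div_lt_one hr]; exact hlt
  have key : ∀ j : ℕ, (z ^ (2 ^ j)).re ≤ ‖z ^ (2 ^ j)‖ * (1 - 2 ^ j * t) := by
    intro j
    induction j with
    | zero =>
      simp only [pow_zero, pow_one, one_mul, ht]
      rw [sub_sub_cancel, mul_div_cancel₀ _ hr.ne']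
    | succ j ih =>
      have hp := hcon (2 ^ j) (by positivity)
      rw [pow_succ 2 j, pow_mul, pow_succ (2:ℝ) j]
      generalize z ^ (2 ^ j) = w at *
      have h1 : w.re ≤ ‖w‖ := Complex.re_le_norm w
      have h2 : ‖w‖ ^ 2 = w.re * w.re + w.im * w.im := by
        rw [Complex.sq_norm, Complex.normSq_apply]
      have h3 : (w ^ 2).re = w.re * w.re - w.im * w.im := by rw [pow_two, Complex.mul_re]
      rw [norm_pow, h3]
      have h4 : w.re * w.re ≤ ‖w‖ * (‖w‖ * (1 - 2 ^ j * t)) :=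
        mul_le_mul h1 ih hp.le (norm_nonneg _)
      nlinarith
  obtain ⟨n, hn⟩ := pow_unbounded_of_one_lt (1 / t) (one_lt_two)
  have h1 : 1 < 2 ^ n * t := by rwa [div_lt_iff₀ htpos] at hn
  have h2 := hcon (2 ^ n) (by positivity)
  have h3 := key n
  nlinarith [norm_nonneg (z ^ (2 ^ n))]

open Polynomial in
lemma aux_quad (z : ℂ) (hz : z.im ≠ 0) :
    ∃ q : ℝ[X], q ≠ 0 ∧ (∀ k, 0 ≤ q.coeff k) ∧
      (X ^ 2 - C (2 * z.re) * X + C (‖z‖ ^ 2) : ℝ[X]) ∣ q := by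
  obtain ⟨m, hm, hre⟩ := aux_pow_re z hz
  refine ⟨X ^ (2 * m) + C (-2 * (z ^ m).re) * X ^ m + C (‖z ^ m‖ ^ 2), ?_, ?_, ?_⟩
  · intro h
    have := congrArg (fun q : ℝ[X] => q.coeff (2 * m)) h
    have e1 : 2 * m ≠ m := by omega
    have e2 : 2 * m ≠ 0 := by omega
    simp only [coeff_add, coeff_X_pow, coeff_C_mul, coeff_C, if_neg e1, if_neg e2, if_true,
      coeff_zero] at this
    norm_num at this
  · intro k
    simp only [coeff_add, coeff_X_pow, coeff_C_mul, coeff_C]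
    have : 0 ≤ -2 * (z ^ m).re := by linarith
    split_ifs <;> simp <;> first | positivity | nlinarith [sq_nonneg (‖z‖ ^ m)]
  · apply quadratic_dvd_of_aeval_eq_zero_im_ne_zero _ _ hz
    simp only [map_add, map_mul, map_pow, aeval_X, aeval_C]
    rw [pow_mul', ]
    generalize z ^ m = w
    apply Complex.ext
    · simp [pow_two, Complex.mul_re, Complex.mul_im]
      have h2 : ‖w‖ * ‖w‖ = w.re * w.re + w.im * w.im := by
        rw [← pow_two, Complex.sq_norm, Complex.normSq_apply]
      nlinarith
    · simp [pow_two, Complex.mul_re, Complex.mul_im]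
      ring

open Polynomial in
lemma aux_nonneg_mul {p q : ℝ[X]} (hp : ∀ k, 0 ≤ p.coeff k) (hq : ∀ k, 0 ≤ q.coeff k) :
    ∀ k, 0 ≤ (p * q).coeff k := by
  intro k
  rw [coeff_mul]
  exact Finset.sum_nonneg fun i _ => mul_nonneg (hp _) (hq _)

open Polynomial in
lemma aux_poincare (n : ℕ) : ∀ p : ℝ[X], p.natDegree ≤ n → p ≠ 0 →
    (∀ z : ℂ, aeval z p = 0 → z.im ≠ 0) →
    ∃ q : ℝ[X], q ≠ 0 ∧ (∀ k, 0 ≤ q.coeff k) ∧ p ∣ q := by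
  induction n with
  | zero =>
    intro p hp h0 _
    rw [eq_C_of_natDegree_le_zero hp] at h0 ⊢
    have hc : p.coeff 0 ≠ 0 := by simpa using h0
    refine ⟨1, one_ne_zero, ?_, (isUnit_C.mpr hc.isUnit).dvd⟩
    intro k
    rw [coeff_one]; split_ifs <;> simp
  | succ n ih =>
    intro p hp h0 hroots
    by_cases hd : p.natDegree = 0
    · exact ih p (by omega) h0 hroots
    obtain ⟨z, hz⟩ := IsAlgClosed.exists_aeval_eq_zero ℂ p
      (by rw [degree_eq_natDegree h0]; exact_mod_cast hd)
    have him := hroots z hz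
    obtain ⟨r, hr⟩ := quadratic_dvd_of_aeval_eq_zero_im_ne_zero p hz him
    obtain ⟨q1, hq1, hn1, hd1⟩ := aux_quad z him
    set Q : ℝ[X] := X ^ 2 - C (2 * z.re) * X + C (‖z‖ ^ 2) with hQ
    have hQd : Q.natDegree = 2 := by rw [hQ]; compute_degree!
    have hr0 : r ≠ 0 := by rintro rfl; simp at hr; exact h0 hr
    have hQ0 : Q ≠ 0 := by intro h; rw [h] at hQd; simp at hQd
    have hdeg : p.natDegree = 2 + r.natDegree := by rw [hr, natDegree_mul hQ0 hr0, hQd]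
    obtain ⟨q2, hq2, hn2, hd2⟩ := ih r (by omega) hr0 (fun w hw => hroots w (by
      rw [hr, map_mul, hw, mul_zero]))
    exact ⟨q1 * q2, mul_ne_zero hq1 hq2, aux_nonneg_mul hn1 hn2, hr ▸ mul_dvd_mul hd1 hd2⟩

open Polynomial in
lemma aux_no_pos (N : ℕ) (b : ℕ → ℝ) (hbN : b N ≠ 0)
    (hroots : ∀ z : ℂ, ∑ k ∈ Finset.range (N + 1), (b k : ℂ) * z ^ k = 0 → z.im ≠ 0)
    (e : ℕ → ℝ) (he : ∀ k, 0 < e k)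
    (hrec : ∀ j, ∑ k ∈ Finset.range (N + 1), b k * e (k + j) = 0) : False := by
  set p : ℝ[X] := ∑ k ∈ Finset.range (N + 1), C (b k) * X ^ k with hp
  have hp0 : p ≠ 0 := by
    intro h
    have := congrArg (fun q : ℝ[X] => q.coeff N) h
    simp [hp, coeff_X_pow] at this
    exact hbN this
  obtain ⟨q, hq0, hqn, r, hr⟩ := aux_poincare p.natDegree p le_rfl hp0 (by
    intro z hz
    apply hroots z
    simpa [hp] using hz)
  let L : ℝ[X] →ₗ[ℝ] ℝ := Polynomial.lsum fun k => (e k) • LinearMap.id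
  have hLm : ∀ (k : ℕ) (c : ℝ), L (C c * X ^ k) = c * e k := by
    intro k c
    rw [C_mul_X_pow_eq_monomial]
    simp [L, Polynomial.lsum_apply, sum_monomial_index, mul_comm]
  have hL0 : ∀ r : ℝ[X], L (p * r) = 0 := by
    intro r
    induction r using Polynomial.induction_on' with
    | add r s h1 h2 => rw [mul_add, map_add, h1, h2, add_zero]
    | monomial j c =>
      rw [← C_mul_X_pow_eq_monomial, hp, Finset.sum_mul, map_sum]
      have : ∀ k ∈ Finset.range (N + 1),
          L (C (b k) * X ^ k * (C c * X ^ j)) = c * (b k * e (k + j)) := by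
        intro k _
        have : (C (b k) * X ^ k * (C c * X ^ j) : ℝ[X]) = C (c * b k) * X ^ (k + j) := by
          rw [C_mul, pow_add]; ring
        rw [this, hLm, mul_assoc]
      rw [Finset.sum_congr rfl this, ← Finset.mul_sum, hrec, mul_zero]
  have h1 : L q = 0 := by rw [hr]; exact hL0 r
  have h2 : 0 < L q := by
    have : L q = ∑ k ∈ q.support, e k * q.coeff k := by
      simp [L, Polynomial.lsum_apply, Polynomial.sum_def]
    rw [this]
    apply Finset.sum_pos
    · intro k hk
      exact mul_pos (he k) (lt_of_le_of_ne (hqn k) (Ne.symm (mem_support_iff.mp hk)))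
    · exact nonempty_support_iff.mpr hq0
  linarith

/-- Version with a sign `s = ±1`: `d k * d (k+1)` has sign `s`. -/
lemma aux_no_sign (N : ℕ) (a : ℕ → ℝ) (haN : a N ≠ 0)
    (hroots : ∀ z : ℂ, ∑ k ∈ Finset.range (N + 1), (a k : ℂ) * z ^ k = 0 → z.im ≠ 0)
    (s : ℝ) (hs : s * s = 1)
    (d : ℕ → ℝ) (hd0 : d 0 ≠ 0) (hd : ∀ k, d k ≠ 0 → 0 < s * (d k * d (k + 1)))
    (hrec : ∀ j, ∑ k ∈ Finset.range (N + 1), a k * d (k + j) = 0) : False := by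
  have hs0 : s ≠ 0 := by rintro rfl; simp at hs
  have hsk : ∀ k : ℕ, s ^ k * s ^ k = 1 := fun k => by rw [← mul_pow, hs, one_pow]
  refine aux_no_pos N (fun k => a k * s ^ k) (mul_ne_zero haN (pow_ne_zero _ hs0)) ?_
    (fun k => s ^ k * d k * d 0) ?_ ?_
  · intro z hz
    have := hroots (s * z) (by
      rw [← hz]
      apply Finset.sum_congr rfl
      intro k _
      push_cast
      ring)
    intro h
    apply this
    simp [h]
  · intro k
    induction k with
    | zero => simpa using mul_self_pos.mpr hd0
    | succ k ih =>
      have hk : d k ≠ 0 := by intro h; simp [h] at ih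
      have h1 := mul_pos ih (hd k hk)
      have h2 : 0 < d k * d k := mul_self_pos.mpr hk
      have h3 : s ^ k * d k * d 0 * (s * (d k * d (k + 1)))
        = (d k * d k) * (s ^ (k + 1) * d (k + 1) * d 0) := by ring
      rw [h3] at h1
      exact pos_of_mul_pos_right h1 h2.le
  · intro j
    have : ∀ k ∈ Finset.range (N + 1), a k * s ^ k * (s ^ (k + j) * d (k + j) * d 0)
        = s ^ j * d 0 * (a k * d (k + j)) := by
      intro k _
      rw [pow_add]
      linear_combination a k * s ^ j * d (k + j) * d 0 * hsk k
    rw [Finset.sum_congr rfl this, ← Finset.mul_sum, hrec, mul_zero]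

/-- If all complex roots of the characteristic polynomial `a_N r^N + … + a_1 r + a_0`
(with `a_0 ≠ 0` and `a_N ≠ 0`) are non-real, then the polynomial-like iterative equation
`a_N g^N(x) + … + a_1 g(x) + a_0 x = 0` has no continuous solution `g : I → I` on a
nondegenerate interval `I`. -/
theorem no_continuous_solution_of_all_roots_nonreal
    (I : Set ℝ) (hI : I.OrdConnected) (hne : ∃ a ∈ I, ∃ b ∈ I, a ≠ b)
    (N : ℕ) (hN : 0 < N) (a : ℕ → ℝ) (ha0 : a 0 ≠ 0) (haN : a N ≠ 0)
    (hroots : ∀ z : ℂ, ∑ k ∈ Finset.range (N + 1), (a k : ℂ) * z ^ k = 0 → z.im ≠ 0) :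
    ∀ g : ℝ → ℝ, Set.MapsTo g I I → ContinuousOn g I →
      ¬ (∀ x ∈ I, ∑ k ∈ Finset.range (N + 1), a k * g^[k] x = 0) := by
  intro g hmaps hcont heq
  have hinj : Set.InjOn g I := by
    intro x hx y hy hxy
    have h1 := heq x hx
    have h2 := heq y hy
    rw [Finset.sum_range_succ'] at h1 h2
    simp only [Function.iterate_succ_apply, hxy, Function.iterate_zero, id] at h1 h2
    exact mul_left_cancel₀ ha0 (by linarith)
  obtain ⟨x, hx, hx0⟩ : ∃ x ∈ I, x ≠ 0 := by
    obtain ⟨u, hu, v, hv, huv⟩ := hne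
    by_cases h : u = 0
    · exact ⟨v, hv, fun h' => huv (h.trans h'.symm)⟩
    · exact ⟨u, hu, h⟩
  have hfix : g x ≠ x := by
    intro h
    have h1 := heq x hx
    simp only [Function.iterate_fixed h] at h1
    rw [← Finset.sum_mul] at h1
    have h2 : ∑ k ∈ Finset.range (N + 1), a k = 0 := (mul_eq_zero.mp h1).resolve_right hx0
    have := hroots 1 (by simp only [one_pow, mul_one]; exact_mod_cast h2)
    simp at this
  have hmem : ∀ k, g^[k] x ∈ I := fun k => hmaps.iterate k hx
  have hrec : ∀ j, ∑ k ∈ Finset.range (N + 1),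
      a k * (g^[k + j + 1] x - g^[k + j] x) = 0 := by
    intro j
    have h1 := heq _ (hmem (j + 1))
    have h2 := heq _ (hmem j)
    simp only [← Function.iterate_add_apply] at h1 h2
    simp only [mul_sub, Finset.sum_sub_distrib, add_assoc]
    rw [h1, h2, sub_zero]
  have hd0 : g^[0 + 1] x - g^[0] x ≠ 0 := by simpa [sub_eq_zero] using hfix
  have hmono : StrictMonoOn g I ∨ StrictAntiOn g I := by
    have : Inhabited I := ⟨⟨x, hx⟩⟩
    have h : StrictMono (Set.domRestrict I g) ∨ StrictAnti (Set.domRestrict I g) :=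
      Continuous.strictMono_of_inj hcont.domRestrict hinj.injective
    exact h.imp strictMono_domRestrict.mp (fun h u hu v hv huv => @h ⟨u, hu⟩ ⟨v, hv⟩ huv)
  rcases hmono with hm | hm
  · refine aux_no_sign N a haN hroots 1 (by norm_num)
      (fun k => g^[k + 1] x - g^[k] x) hd0 ?_ hrec
    intro k hk
    simp only [Function.iterate_succ_apply' g] at hk ⊢
    have hu := hmem k
    generalize g^[k] x = u at *
    rcases lt_or_gt_of_ne (sub_ne_zero.mp hk) with h | h
    · have := hm (hmaps hu) hu h
      nlinarith
    · have := hm hu (hmaps hu) h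
      nlinarith
  · refine aux_no_sign N a haN hroots (-1) (by norm_num)
      (fun k => g^[k + 1] x - g^[k] x) hd0 ?_ hrec
    intro k hk
    simp only [Function.iterate_succ_apply' g] at hk ⊢
    have hu := hmem k
    generalize g^[k] x = u at *
    rcases lt_or_gt_of_ne (sub_ne_zero.mp hk) with h | h
    · have := hm (hmaps hu) hu h
      nlinarith
    · have := hm hu (hmaps hu) h
      nlinarith
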